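/- arXiv:1904.00576 — 3 statements merged into one kernel-verified Lean document; each statement's English description precedes it below -/
import Mathlib

section
/- For any z ∈ 𝒰 and r > 0, the Lebesgue measure of the Bergman metric ball D(z,r) equals |D(z,r)| = (4πⁿ/n!) · (tanh^{2n} r)/(1 − tanh² r)^{n+1} · ρ(z)^{n+1}. -/
open MeasureTheory Filter

noncomputable section

/-- Points of ℂⁿ written `z = (z′, zₙ)` with `z′ ∈ ℂ^m`, `m = n - 1`. -/
abbrev SPoint (m : ℕ) := (Fin m → ℂ) × ℂ

/-- `ρ(z,w) = (i/2)(w̄ₙ − zₙ) − z′·w̄′`. -/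
def srho2 {m : ℕ} (z w : SPoint m) : ℂ :=
  Complex.I / 2 * ((starRingEnd ℂ) w.2 - z.2) - ∑ j, z.1 j * (starRingEnd ℂ) (w.1 j)

/-- `ρ(z) = Im zₙ − |z′|²`. -/
def srho {m : ℕ} (z : SPoint m) : ℝ :=
  z.2.im - ∑ j, ‖z.1 j‖ ^ 2

/-- The Siegel upper half-space `𝒰 = {z : ρ(z) > 0}`. -/
def Siegel (m : ℕ) : Set (SPoint m) := {z | 0 < srho z}

/-- The Bergman kernel `K(z,w) = (n!/(4πⁿ)) ρ(z,w)^{−(n+1)}` (points in ℂⁿ = ℂ^{n-1} × ℂ). -/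
def sK (n : ℕ) (z w : SPoint (n - 1)) : ℂ :=
  (n.factorial : ℂ) / (4 * (Real.pi : ℂ) ^ n) * srho2 z w ^ (-(n + 1 : ℤ))

/-- Inverse hyperbolic tangent. -/
def artanh (x : ℝ) : ℝ := (1 / 2) * Real.log ((1 + x) / (1 - x))

/-- The Bergman distance `β(z,w) = artanh √(1 − ρ(z)ρ(w)/|ρ(z,w)|²)`. -/
def sbeta {m : ℕ} (z w : SPoint m) : ℝ :=
  artanh (Real.sqrt (1 - srho z * srho w / ‖srho2 z w‖ ^ 2))

/-- The Bergman metric ball `D(z,r)`. -/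
def sball {m : ℕ} (z : SPoint m) (r : ℝ) : Set (SPoint m) :=
  {w ∈ Siegel m | sbeta z w < r}

/-- Membership in the Bergman space `Aᵖ(𝒰)`: holomorphic with `∫_𝒰 |f|ᵖ dV < ∞`. -/
def MemAp (n : ℕ) (p : ℝ) (f : SPoint (n - 1) → ℂ) : Prop :=
  DifferentiableOn ℂ f (Siegel (n - 1)) ∧
    IntegrableOn (fun z => ‖f z‖ ^ p) (Siegel (n - 1)) volume

/-- `‖f‖ₚ = (∫_𝒰 |f|ᵖ dV)^{1/p}`. -/
def bNorm (n : ℕ) (p : ℝ) (f : SPoint (n - 1) → ℂ) : ℝ :=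
  (∫ z in Siegel (n - 1), ‖f z‖ ^ p) ^ (1 / p)

/-- The space `𝒮_α` of holomorphic `f` on `𝒰` with `sup_z |zₙ + i|^α |f(z)| < ∞`. -/
def SAlpha (n : ℕ) (α : ℝ) (f : SPoint (n - 1) → ℂ) : Prop :=
  DifferentiableOn ℂ f (Siegel (n - 1)) ∧
    ∃ M : ℝ, ∀ z ∈ Siegel (n - 1), ‖z.2 + Complex.I‖ ^ α * ‖f z‖ ≤ M

end
/-- Volume of the Euclidean ball of radius `R` in `ℂ^m × ℂ`. -/
theorem volume_prod_complex_ball (m : ℕ) {R : ℝ} (hR : 0 < R) :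
    volume {p : SPoint m | ∑ j, ‖p.1 j‖ ^ 2 + ‖p.2‖ ^ 2 < R ^ 2} =
      ENNReal.ofReal (Real.pi ^ (m + 1) / ((m + 1).factorial : ℝ) * R ^ (2 * (m + 1))) := by
  have hball := Complex.volume_sum_rpow_lt (Fin (m + 1)) (p := 2) (by norm_num) R
  have hset : {x : Fin (m + 1) → ℂ | (∑ i, ‖x i‖ ^ (2 : ℝ)) ^ (1 / (2 : ℝ)) < R} =
      (fun x => ((MeasurableEquiv.piFinSuccAbove (fun _ => ℂ) (Fin.last m)) x).swap) ⁻¹'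
        {p : SPoint m | ∑ j, ‖p.1 j‖ ^ 2 + ‖p.2‖ ^ 2 < R ^ 2} := by
    ext x
    simp only [Set.mem_ofPred_eq, Set.mem_preimage, Real.rpow_two, ← Real.sqrt_eq_rpow,
      Real.sqrt_lt' hR, Fin.sum_univ_castSucc]
    simp [MeasurableEquiv.piFinSuccAbove, Fin.insertNthEquiv, Fin.init]
  have hmp : MeasurePreserving (fun x : Fin (m + 1) → ℂ =>
      ((MeasurableEquiv.piFinSuccAbove (fun _ => ℂ) (Fin.last m)) x).swap) volume volume :=
    Measure.measurePreserving_swap.comp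
      (volume_preserving_piFinSuccAbove (fun _ : Fin (m + 1) => ℂ) (Fin.last m))
  have hmeas : MeasurableSet {p : SPoint m | ∑ j, ‖p.1 j‖ ^ 2 + ‖p.2‖ ^ 2 < R ^ 2} :=
    (isOpen_lt (by fun_prop) (by fun_prop)).measurableSet
  rw [hset, hmp.measure_preimage hmeas.nullMeasurableSet] at hball
  rw [hball, ← ENNReal.ofReal_pow hR.le, ← ENNReal.ofReal_mul (by positivity)]
  have h₁ : (2 : ℝ) / 2 + 1 = 2 := by norm_num
  have h₂ : (2 : ℝ) * (Fintype.card (Fin (m + 1)) : ℝ) / 2 + 1 = ((m + 1 : ℕ) : ℝ) + 1 := by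
    simp
  rw [h₁, h₂, Real.Gamma_two, Real.Gamma_nat_eq_factorial, Fintype.card_fin, mul_one, mul_comm]

/-- Volume of an ellipsoid in `ℂ^m × ℂ` whose semi-axes are `R / k` in the directions of `ℂ^m`
and `R` in the last direction. -/
theorem volume_prod_complex_ellipsoid (m : ℕ) {k R : ℝ} (hk : 0 < k) (hR : 0 < R) :
    volume {p : SPoint m | k ^ 2 * ∑ j, ‖p.1 j‖ ^ 2 + ‖p.2‖ ^ 2 < R ^ 2} =
      ENNReal.ofReal (Real.pi ^ (m + 1) / ((m + 1).factorial : ℝ) * R ^ (2 * (m + 1)) /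
        k ^ (2 * m)) := by
  have hset : {p : SPoint m | k ^ 2 * ∑ j, ‖p.1 j‖ ^ 2 + ‖p.2‖ ^ 2 < R ^ 2} =
      Prod.map (k • ·) id ⁻¹' {p : SPoint m | ∑ j, ‖p.1 j‖ ^ 2 + ‖p.2‖ ^ 2 < R ^ 2} := by
    ext p
    simp [mul_pow, Finset.mul_sum]
  have hmeas : MeasurableSet {p : SPoint m | ∑ j, ‖p.1 j‖ ^ 2 + ‖p.2‖ ^ 2 < R ^ 2} :=
    (isOpen_lt (by fun_prop) (by fun_prop)).measurableSet
  have hsmul : Measurable (fun x : Fin m → ℂ => k • x) := measurable_const_smul k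
  rw [hset, ← Measure.map_apply (hsmul.prodMap measurable_id) hmeas, Measure.volume_eq_prod,
    ← Measure.map_prod_map _ _ hsmul measurable_id, Measure.map_addHaar_smul _ hk.ne',
    Measure.map_id, Measure.prod_smul_left, Measure.smul_apply, ← Measure.volume_eq_prod,
    volume_prod_complex_ball m hR, smul_eq_mul, ← ENNReal.ofReal_mul (abs_nonneg _)]
  have hdim : Module.finrank ℝ (Fin m → ℂ) = 2 * m := by
    simp [Module.finrank_pi_fintype, Complex.finrank_real_complex, mul_comm]
  rw [hdim, abs_of_pos (by positivity)]
  congr 1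
  field_simp

theorem tanh_pos_of_pos {r : ℝ} (hr : 0 < r) : 0 < Real.tanh r := by
  rw [Real.tanh_eq_sinh_div_cosh]
  exact div_pos (Real.sinh_pos_iff.2 hr) (Real.cosh_pos r)

theorem one_sub_tanh_sq_pos (r : ℝ) : 0 < 1 - Real.tanh r ^ 2 :=
  sub_pos.2 ((sq_lt_one_iff_abs_lt_one _).2 (Real.abs_tanh_lt_one r))

theorem artanh_lt_iff_lt_tanh {x r : ℝ} (hx : x ∈ Set.Ioo (-1) 1) :
    artanh x < r ↔ x < Real.tanh r := by
  have h : artanh x = Real.artanh x :=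
    (Real.artanh_eq_half_log (Set.Ioo_subset_Icc_self hx)).symm
  rw [h, ← Real.artanh_lt_artanh_iff hx ⟨Real.neg_one_lt_tanh r, Real.tanh_lt_one r⟩,
    Real.artanh_tanh]

/-- The last coordinate of the image of `w` under the Heisenberg translation that carries `z` to
`(0, i ρ(z))`. -/
noncomputable def heisenbergHeight {m : ℕ} (z w : SPoint m) : ℂ :=
  w.2 - (z.2.re + Complex.I * ∑ j, (‖z.1 j‖ ^ 2 : ℝ) +
    2 * Complex.I * ∑ j, (w.1 j - z.1 j) * (starRingEnd ℂ) (z.1 j))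

theorem srho_eq_heisenbergHeight {m : ℕ} (z w : SPoint m) :
    srho w = (heisenbergHeight z w).im - ∑ j, ‖w.1 j - z.1 j‖ ^ 2 := by
  simp only [srho, heisenbergHeight, ← Complex.normSq_eq_norm_sq, Complex.normSq_apply]
  simp [Complex.mul_im, Complex.mul_re, Finset.mul_sum, -Complex.ofReal_sum]
  rw [sub_sub, ← Finset.sum_add_distrib, ← Finset.sum_add_distrib]
  congr 1
  refine Finset.sum_congr rfl fun j _ => ?_
  ring

theorem srho2_eq_heisenbergHeight {m : ℕ} (z w : SPoint m) :
    srho2 z w =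
      Complex.I / 2 * ((starRingEnd ℂ) (heisenbergHeight z w) - Complex.I * srho z) := by
  have hz : z.2 = z.2.re + Complex.I * z.2.im := by
    rw [mul_comm, Complex.re_add_im]
  have hs : ∑ j, ((starRingEnd ℂ) (w.1 j) - (starRingEnd ℂ) (z.1 j)) * z.1 j =
      ∑ j, z.1 j * (starRingEnd ℂ) (w.1 j) - ∑ j, (‖z.1 j‖ : ℂ) ^ 2 := by
    rw [← Finset.sum_sub_distrib]
    refine Finset.sum_congr rfl fun j _ => ?_
    rw [← Complex.mul_conj']
    ring
  simp only [srho2, heisenbergHeight, srho]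
  simp only [map_sub, map_add, map_mul, map_sum, Complex.conj_I, Complex.conj_ofReal,
    Complex.conj_conj, map_ofNat, map_pow, Complex.ofReal_sub, Complex.ofReal_sum, Complex.ofReal_pow, hs]
  nth_rewrite 1 [hz]
  linear_combination (-∑ j, z.1 j * (starRingEnd ℂ) (w.1 j)) *
    Complex.I_sq

theorem four_mul_norm_srho2_sq {m : ℕ} (z w : SPoint m) :
    4 * ‖srho2 z w‖ ^ 2 =
      (heisenbergHeight z w).re ^ 2 + ((heisenbergHeight z w).im + srho z) ^ 2 := by
  rw [srho2_eq_heisenbergHeight, norm_mul, mul_pow, ← Complex.normSq_eq_norm_sq (_ - _),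
    Complex.normSq_apply]
  simp
  ring

/-- In Heisenberg coordinates, a Bergman ball is a Euclidean ellipsoid. -/
theorem mem_sball_iff {m : ℕ} {z : SPoint m} (hz : z ∈ Siegel m) {r : ℝ} (hr : 0 < r)
    (w : SPoint m) :
    w ∈ sball z r ↔
      4 * srho z / (1 - Real.tanh r ^ 2) * ∑ j, ‖w.1 j - z.1 j‖ ^ 2 +
        ‖heisenbergHeight z w -
          Complex.I * (srho z * (2 / (1 - Real.tanh r ^ 2) - 1) : ℝ)‖ ^ 2 <
      (2 * Real.tanh r * srho z / (1 - Real.tanh r ^ 2)) ^ 2 := by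
  have hc : 0 < srho z := hz
  have ht : 0 < Real.tanh r := tanh_pos_of_pos hr
  have hs : 0 < 1 - Real.tanh r ^ 2 := one_sub_tanh_sq_pos r
  have hD := four_mul_norm_srho2_sq z w
  have hw := srho_eq_heisenbergHeight z w
  have hN : 0 ≤ ∑ j, ‖w.1 j - z.1 j‖ ^ 2 := by positivity
  rw [← Complex.normSq_eq_norm_sq, Complex.normSq_apply]
  simp only [Complex.sub_re, Complex.sub_im, Complex.re_mul_ofReal, Complex.im_mul_ofReal,
    Complex.I_re, Complex.I_im, zero_mul, one_mul, sub_zero]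
  generalize heisenbergHeight z w = η at *
  generalize ∑ j, ‖w.1 j - z.1 j‖ ^ 2 = N at *
  generalize hcdef : srho z = c at *
  have hs1 : Real.tanh r ^ 2 = 1 - (1 - Real.tanh r ^ 2) := by ring
  have key : 4 * c / (1 - Real.tanh r ^ 2) * N + (η.re * η.re +
      (η.im - c * (2 / (1 - Real.tanh r ^ 2) - 1)) *
        (η.im - c * (2 / (1 - Real.tanh r ^ 2) - 1))) <
      (2 * Real.tanh r * c / (1 - Real.tanh r ^ 2)) ^ 2 ↔
      (1 - Real.tanh r ^ 2) * ‖srho2 z w‖ ^ 2 < c * srho w := by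
    have hD' : ‖srho2 z w‖ ^ 2 = (η.re ^ 2 + (η.im + c) ^ 2) / 4 := by linarith
    rw [hD', hw, ← sub_neg, ← sub_neg (a := _ * (_ / 4)), div_pow, mul_pow, mul_pow, hs1]
    generalize 1 - Real.tanh r ^ 2 = s at hs
    have : 4 * c / s * N + (η.re * η.re +
      (η.im - c * (2 / s - 1)) * (η.im - c * (2 / s - 1))) - 2 ^ 2 * (1 - s) * c ^ 2 / s ^ 2 =
      4 / s * (s * ((η.re ^ 2 + (η.im + c) ^ 2) / 4) - c * (η.im - N)) := by
      field_simp
      ring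
    rw [sub_sub_cancel, this]
    have h4 : 0 < 4 / s := by positivity
    exact ⟨fun h => neg_of_mul_neg_right h h4.le, mul_neg_of_pos_of_neg h4⟩
  rw [key]
  have hpos : 0 < srho w → (sbeta z w < r ↔
      (1 - Real.tanh r ^ 2) * ‖srho2 z w‖ ^ 2 < c * srho w) := by
    intro hw0
    have hn : 0 < ‖srho2 z w‖ ^ 2 := by nlinarith [sq_nonneg η.re]
    have hq : 0 < c * srho w / ‖srho2 z w‖ ^ 2 := by positivity
    rw [sbeta, hcdef, artanh_lt_iff_lt_tanh, Real.sqrt_lt' ht, sub_lt_comm, lt_div_iff₀ hn]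
    refine ⟨by linarith [Real.sqrt_nonneg (1 - c * srho w / ‖srho2 z w‖ ^ 2)], ?_⟩
    rw [Real.sqrt_lt' one_pos]
    linarith
  constructor
  · rintro ⟨h₀, h⟩
    exact (hpos h₀).1 h
  · intro h
    have h₀ : 0 < srho w := by
      have : 0 < c * srho w := lt_of_le_of_lt (by positivity) h
      exact (pos_iff_pos_of_mul_pos this).1 hc
    exact ⟨h₀, (hpos h₀).2 h⟩

theorem volume_sball {m : ℕ} {z : SPoint m} (hz : z ∈ Siegel m) {r : ℝ} (hr : 0 < r) :
    volume (sball z r) =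
      ENNReal.ofReal
        (4 * Real.pi ^ (m + 1) / ((m + 1).factorial : ℝ) *
          (Real.tanh r ^ (2 * (m + 1)) / (1 - Real.tanh r ^ 2) ^ (m + 1 + 1)) *
          srho z ^ (m + 1 + 1)) := by
  have hc : 0 < srho z := hz
  have ht : 0 < Real.tanh r := tanh_pos_of_pos hr
  have hs : 0 < 1 - Real.tanh r ^ 2 := one_sub_tanh_sq_pos r
  set k : ℝ := √(4 * srho z / (1 - Real.tanh r ^ 2))
  have hk2 : k ^ 2 = 4 * srho z / (1 - Real.tanh r ^ 2) := Real.sq_sqrt (by positivity)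
  have hk0 : 0 < k := by positivity
  set R : ℝ := 2 * Real.tanh r * srho z / (1 - Real.tanh r ^ 2) with hR
  have hR0 : 0 < R := by positivity
  set b : ℂ := Complex.I * (srho z * (2 / (1 - Real.tanh r ^ 2) - 1) : ℝ)
  have hset : sball z r = (fun w : SPoint m => (w.1 - z.1, heisenbergHeight z w - b)) ⁻¹'
      {p : SPoint m | k ^ 2 * ∑ j, ‖p.1 j‖ ^ 2 + ‖p.2‖ ^ 2 < R ^ 2} := by
    ext w
    rw [mem_sball_iff hz hr, hk2]
    rfl
  have hmeas : MeasurableSet {p : SPoint m | k ^ 2 * ∑ j, ‖p.1 j‖ ^ 2 + ‖p.2‖ ^ 2 < R ^ 2} :=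
    (isOpen_lt (by fun_prop) (by fun_prop)).measurableSet
  have hmp : MeasurePreserving (fun w : SPoint m => (w.1 - z.1, heisenbergHeight z w - b))
      volume volume := by
    refine MeasurePreserving.skew_product (measurePreserving_sub_right volume z.1)
      (g := fun x y => heisenbergHeight z (x, y) - b) ?_ (ae_of_all _ fun x => ?_)
    · unfold Function.uncurry heisenbergHeight
      fun_prop
    · simp only [heisenbergHeight, sub_sub]
      exact (measurePreserving_sub_right volume _).map_eq
  rw [hset, hmp.measure_preimage hmeas.nullMeasurableSet, volume_prod_complex_ellipsoid m hk0 hR0,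
    pow_mul k, hk2, hR]
  congr 1
  have h4 : (2 : ℝ) ^ (2 * (m + 1)) = 4 * 4 ^ m := by
    rw [pow_mul, pow_succ]
    norm_num [mul_comm]
  rw [div_pow, div_pow, mul_pow, mul_pow, mul_pow, h4]
  field_simp
  ring

/-- `|D(z,r)| = (4πⁿ/n!) tanh^{2n}(r)/(1 − tanh²r)^{n+1} · ρ(z)^{n+1}`. -/
theorem bergman_ball_volume (n : ℕ) (hn : 1 ≤ n)
    (z : SPoint (n - 1)) (hz : z ∈ Siegel (n - 1)) (r : ℝ) (hr : 0 < r) :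
    volume (sball z r) =
      ENNReal.ofReal
        (4 * Real.pi ^ n / (n.factorial : ℝ) *
          (Real.tanh r ^ (2 * n) / (1 - Real.tanh r ^ 2) ^ (n + 1)) *
          srho z ^ (n + 1)) := by
  obtain ⟨m, rfl⟩ := Nat.exists_eq_add_of_le' hn
  exact volume_sball hz hr
end

section
/- Suppose 0 < p < ∞. Then for every f ∈ Aᵖ(𝒰) and every z ∈ 𝒰, |f(z)| ≤ (4ⁿ n!/πⁿ)^{1/p} · ‖f‖ₚ / ρ(z)^{(n+1)/p}. -/
open MeasureTheory Filter

/-- Sub-mean value property of `‖g‖ ^ p` on the unit circle. -/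
theorem norm_rpow_le_circleAverage {g : ℂ → ℂ}
    (hg : AnalyticOnNhd ℂ g (Metric.closedBall 0 1)) {p : ℝ} (hp : 0 < p) :
    ‖g 0‖ ^ p ≤ Real.circleAverage (fun z => ‖g z‖ ^ p) 0 1 := by
  have hcont : ContinuousOn (fun z => ‖g z‖ ^ p) (Metric.sphere 0 |1|) := by
    have : ContinuousOn g (Metric.sphere 0 |1|) :=
      hg.continuousOn.mono (by simpa using Metric.sphere_subset_closedBall)
    exact this.norm.rpow_const fun _ _ => Or.inr hp.le
  have hint : CircleIntegrable (fun z => ‖g z‖ ^ p) 0 1 := hcont.circleIntegrable'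
  by_cases h0 : g 0 = 0
  · rw [h0, norm_zero, Real.zero_rpow hp.ne']
    exact Real.circleAverage_nonneg_of_nonneg fun z _ => by positivity
  set a : ℝ := ‖g 0‖ ^ p with ha
  have ha0 : 0 < a := Real.rpow_pos_of_pos (norm_pos_iff.2 h0) p
  have hlog_int : CircleIntegrable (fun z => Real.log ‖g z‖) 0 1 :=
    MeromorphicOn.circleIntegrable_log_norm
      (hg.meromorphicOn.mono_set (by simpa using Metric.sphere_subset_closedBall))
  have hjensen : Real.log ‖g 0‖ ≤ Real.circleAverage (fun z => Real.log ‖g z‖) 0 1 := by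
    have hg' : AnalyticOnNhd ℂ g (Metric.closedBall 0 |1|) := by simpa using hg
    rw [hg'.circleAverage_log_norm one_ne_zero h0]
    refine le_add_of_nonneg_left (finsum_nonneg fun u => ?_)
    by_cases hu : u ∈ Metric.closedBall (0 : ℂ) |1|
    · refine mul_nonneg ?_ ?_
      · exact_mod_cast (MeromorphicOn.AnalyticOnNhd.divisor_nonneg hg') u
      · rcases eq_or_ne u 0 with rfl | hu0
        · simp
        · refine Real.log_nonneg ?_
          simp only [zero_sub, norm_neg, one_mul]
          exact (one_le_inv₀ (norm_pos_iff.2 hu0)).2 (by simpa using hu)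
    · rw [Function.locallyFinsuppWithin.apply_eq_zero_of_notMem _ hu]
      simp
  set F : ℂ → ℝ := fun z => a * (1 - Real.log a) + (a * p) • Real.log ‖g z‖ with hF
  have hlog_smul : CircleIntegrable (fun z => (a * p) • Real.log ‖g z‖) 0 1 := hlog_int.const_smul
  have hF_int : CircleIntegrable F 0 1 := (circleIntegrable_const _ _ _).add hlog_smul
  have hF_avg : a ≤ Real.circleAverage F 0 1 := by
    rw [hF, Real.circleAverage_fun_add (circleIntegrable_const _ _ _) hlog_smul,
      Real.circleAverage_const, Real.circleAverage_fun_smul, smul_eq_mul]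
    have : Real.log a = p * Real.log ‖g 0‖ := Real.log_rpow (norm_pos_iff.2 h0) p
    have h2 := mul_le_mul_of_nonneg_left hjensen (mul_pos ha0 hp).le
    rw [this]
    linarith
  set G : ℂ → ℝ := fun z => if g z = 0 then 0 else F z with hG
  have hFG : F =ᶠ[codiscreteWithin (Metric.sphere 0 |1|)] G := by
    have hne : ∀ᶠ z in codiscreteWithin (Metric.closedBall (0 : ℂ) 1), g z ≠ 0 := by
      refine (hg.eqOn_zero_or_eventually_ne_zero_of_preconnected
        (convex_closedBall _ _).isPreconnected).resolve_left fun h => h0 (h (by simp))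
    have hne' := codiscreteWithin_mono (show Metric.sphere (0 : ℂ) |1| ⊆ Metric.closedBall 0 1 by
      simpa using Metric.sphere_subset_closedBall) hne
    filter_upwards [hne'] with z hz
    simp only [hG]
    rw [if_neg hz]
  have hG_int : CircleIntegrable G 0 1 := hF_int.congr_codiscreteWithin hFG
  rw [Real.circleAverage_congr_codiscreteWithin hFG one_ne_zero] at hF_avg
  refine hF_avg.trans (Real.circleAverage_mono hG_int hint fun z _ => ?_)
  simp only [hG]
  split_ifs with hz
  · positivity
  · have hz' := norm_pos_iff.2 hz
    have hb := Real.rpow_pos_of_pos hz' p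
    have h1 := Real.log_le_sub_one_of_pos (div_pos hb ha0)
    rw [Real.log_div hb.ne' ha0.ne', Real.log_rpow hz'] at h1
    have h2 := mul_le_mul_of_nonneg_left h1 ha0.le
    have h3 : a * (‖g z‖ ^ p / a - 1) = ‖g z‖ ^ p - a := by field_simp
    simp only [hF, smul_eq_mul]
    rw [h3] at h2
    linarith

theorem ofReal_norm_rpow_le_lintegral_circle {g : ℂ → ℂ}
    (hg : AnalyticOnNhd ℂ g (Metric.closedBall 0 1)) {p : ℝ} (hp : 0 < p) :
    ENNReal.ofReal (2 * Real.pi) * ENNReal.ofReal (‖g 0‖ ^ p) ≤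
      ∫⁻ θ in Set.Ioc 0 (2 * Real.pi), ENNReal.ofReal (‖g (circleMap 0 1 θ)‖ ^ p) := by
  have hcont : Continuous fun θ => ‖g (circleMap 0 1 θ)‖ ^ p := by
    have : Continuous fun θ => g (circleMap 0 1 θ) :=
      hg.continuousOn.comp_continuous (continuous_circleMap 0 1) fun θ => by simp
    exact this.norm.rpow_const fun _ => Or.inr hp.le
  have h := norm_rpow_le_circleAverage hg hp
  rw [Real.circleAverage_def, smul_eq_mul, inv_mul_eq_div, le_div_iff₀' Real.two_pi_pos,
    intervalIntegral.integral_of_le Real.two_pi_pos.le] at h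
  rw [← ENNReal.ofReal_mul Real.two_pi_pos.le, ← ofReal_integral_eq_lintegral_ofReal]
  · exact ENNReal.ofReal_le_ofReal h
  · exact (hcont.integrableOn_Icc).mono_set Set.Ioc_subset_Icc_self
  · exact Eventually.of_forall fun θ => by positivity

theorem measurePreserving_smul_of_norm_eq_one (m : ℕ) {c : ℂ} (hc : ‖c‖ = 1) :
    MeasurePreserving (fun w : SPoint m => c • w) := by
  have h1 : MeasurePreserving (fun z : ℂ => c • z) :=
    (rotation ⟨c, mem_sphere_zero_iff_norm.2 hc⟩).measurePreserving
  exact (volume_preserving_pi fun _ : Fin m => h1).prod h1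

/-- The Heisenberg translation taking `0` to `z`. -/
def heisenbergTranslate {m : ℕ} (z w : SPoint m) : SPoint m :=
  (z.1 + w.1, z.2 + 2 * Complex.I * ∑ j, w.1 j * (starRingEnd ℂ) (z.1 j) + w.2)

theorem heisenbergTranslate_zero {m : ℕ} (z : SPoint m) : heisenbergTranslate z 0 = z := by
  simp [heisenbergTranslate]

theorem srho_heisenbergTranslate {m : ℕ} (z w : SPoint m) :
    srho (heisenbergTranslate z w) = srho z + w.2.im - ∑ j, ‖w.1 j‖ ^ 2 := by
  have h (a b : ℂ) : ‖a + b‖ ^ 2 = ‖a‖ ^ 2 + ‖b‖ ^ 2 + 2 * (b * (starRingEnd ℂ) a).re := by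
    simp only [← Complex.normSq_eq_norm_sq, Complex.normSq_apply, Complex.add_re, Complex.add_im,
      Complex.mul_re, Complex.conj_re, Complex.conj_im]
    ring
  simp only [srho, heisenbergTranslate, Pi.add_apply, h, Finset.sum_add_distrib, Complex.add_im,
    ← Finset.mul_sum, ← Complex.re_sum]
  simp [Complex.mul_im]
  ring

theorem measurePreserving_heisenbergTranslate {m : ℕ} (z : SPoint m) :
    MeasurePreserving (heisenbergTranslate z) := by
  refine (measurePreserving_add_left volume z.1).skew_product
    (g := fun x y => z.2 + 2 * Complex.I * ∑ j, x j * (starRingEnd ℂ) (z.1 j) + y) ?_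
    (Eventually.of_forall fun x => map_add_left_eq_self volume _)
  unfold Function.uncurry
  fun_prop

theorem differentiable_heisenbergTranslate {m : ℕ} (z : SPoint m) :
    Differentiable ℂ (heisenbergTranslate z) := by
  unfold heisenbergTranslate
  fun_prop

theorem mem_siegel_iff {m : ℕ} {z : SPoint m} : z ∈ Siegel m ↔ 0 < srho z := by
  rw [Siegel, Set.mem_ofPred_eq]

theorem isOpen_siegel (m : ℕ) : IsOpen (Siegel m) := by
  refine isOpen_lt continuous_const ?_
  unfold srho
  fun_prop

/-- A ball in `ℂ ^ m` of radius `√r` times a disc of radius `r`. -/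
def ballProdDisc (m : ℕ) (r : ℝ) : Set (SPoint m) :=
  {x : Fin m → ℂ | ∑ j, ‖x j‖ ^ 2 < r} ×ˢ Metric.ball (0 : ℂ) r

theorem measurableSet_ballProdDisc (m : ℕ) (r : ℝ) : MeasurableSet (ballProdDisc m r) :=
  (isOpen_lt (by fun_prop) continuous_const).measurableSet.prod Metric.isOpen_ball.measurableSet

theorem volume_ballProdDisc (m : ℕ) {r : ℝ} (hr : 0 < r) :
    volume (ballProdDisc m r) =
      ENNReal.ofReal ((Real.pi * r) ^ m / m.factorial * (Real.pi * r ^ 2)) := by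
  have hball : volume {x : Fin m → ℂ | ∑ j, ‖x j‖ ^ 2 < r} =
      ENNReal.ofReal ((Real.pi * r) ^ m / m.factorial) := by
    rcases Nat.eq_zero_or_pos m with rfl | hm
    · simp [hr, volume_pi]
    have : Nonempty (Fin m) := ⟨⟨0, hm⟩⟩
    have h := Complex.volume_sum_rpow_lt (Fin m) (p := 2) one_le_two (Real.sqrt r)
    have hset : {x : Fin m → ℂ | (∑ i, ‖x i‖ ^ (2 : ℝ)) ^ (1 / (2 : ℝ)) < Real.sqrt r} =
        {x : Fin m → ℂ | ∑ j, ‖x j‖ ^ 2 < r} := by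
      ext x
      simp only [Set.mem_ofPred_eq, Real.rpow_two, ← Real.sqrt_eq_rpow]
      exact Real.sqrt_lt_sqrt_iff (by positivity)
    rw [hset, Fintype.card_fin, ← ENNReal.ofReal_pow (Real.sqrt_nonneg r),
      ← ENNReal.ofReal_mul (by positivity), pow_mul, Real.sq_sqrt hr.le] at h
    rw [h]
    congr 1
    have h2 : Real.Gamma ((2 : ℝ) / 2 + 1) = 1 := by norm_num
    have h3 : Real.Gamma (2 * (m : ℝ) / 2 + 1) = m.factorial := by
      rw [mul_div_cancel_left₀ _ two_ne_zero, Real.Gamma_nat_eq_factorial]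
    rw [h2, h3, mul_one, mul_pow]
    ring
  rw [ballProdDisc, Measure.volume_eq_prod, Measure.prod_prod, hball, Complex.volume_ball,
    ENNReal.ofReal_mul (by positivity), mul_comm Real.pi (r ^ 2),
    ENNReal.ofReal_mul (by positivity), ENNReal.ofReal_pow hr.le]
  congr 2
  exact (ENNReal.ofReal_coe_nnreal (p := NNReal.pi)).symm

theorem heisenbergTranslate_smul_mem {m : ℕ} {z w : SPoint m}
    (hw : w ∈ ballProdDisc m (srho z / 2)) {c : ℂ} (hc : ‖c‖ ≤ 1) :
    heisenbergTranslate z (c • w) ∈ Siegel m := by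
  obtain ⟨h1, h2⟩ := hw
  rw [Set.mem_ofPred_eq] at h1
  rw [mem_ball_zero_iff] at h2
  rw [mem_siegel_iff, srho_heisenbergTranslate]
  have h3 : ∑ j, ‖(c • w).1 j‖ ^ 2 ≤ ∑ j, ‖w.1 j‖ ^ 2 := by
    refine Finset.sum_le_sum fun j _ => ?_
    have : ‖(c • w).1 j‖ ≤ ‖w.1 j‖ := by
      simpa using mul_le_of_le_one_left (norm_nonneg (w.1 j)) hc
    gcongr
  have h4 : ‖(c • w).2‖ ≤ ‖w.2‖ := by
    simpa using mul_le_of_le_one_left (norm_nonneg w.2) hc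
  have h5 := (abs_le.1 (Complex.abs_im_le_norm (c • w).2)).1
  linarith

/-- Sub-mean value estimate for `‖f‖ ^ p` over the Heisenberg translate of a circular set. -/
theorem norm_rpow_mul_volume_le {m : ℕ} {p : ℝ} (hp : 0 < p) {f : SPoint m → ℂ}
    (hf : DifferentiableOn ℂ f (Siegel m)) (z : SPoint m) :
    ENNReal.ofReal (‖f z‖ ^ p) * volume (ballProdDisc m (srho z / 2)) ≤
      ∫⁻ w in Siegel m, ENNReal.ofReal (‖f w‖ ^ p) := by
  set F : SPoint m → ENNReal := (Siegel m).indicator fun w => ENNReal.ofReal (‖f w‖ ^ p) with hF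
  have hU := (isOpen_siegel m).measurableSet
  have hFm : Measurable F := by
    classical
    have hc : ContinuousOn (fun w => ENNReal.ofReal (‖f w‖ ^ p)) (Siegel m) :=
      ENNReal.continuous_ofReal.comp_continuousOn
        (hf.continuousOn.norm.rpow_const fun _ _ => Or.inr hp.le)
    rw [hF, ← Set.piecewise_eq_indicator]
    exact hc.measurable_piecewise continuousOn_const hU
  have hT := measurePreserving_heisenbergTranslate z
  have hslice : ∀ w ∈ ballProdDisc m (srho z / 2),
      ENNReal.ofReal (2 * Real.pi) * ENNReal.ofReal (‖f z‖ ^ p) ≤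
        ∫⁻ θ in Set.Ioc 0 (2 * Real.pi), F (heisenbergTranslate z (circleMap 0 1 θ • w)) := by
    intro w hw
    have han : AnalyticOnNhd ℂ (fun c : ℂ => f (heisenbergTranslate z (c • w)))
        (Metric.closedBall 0 1) := by
      have hd : Differentiable ℂ fun c : ℂ => heisenbergTranslate z (c • w) :=
        (differentiable_heisenbergTranslate z).comp (differentiable_id.smul_const w)
      have hopen := (isOpen_siegel m).preimage hd.continuous
      exact ((hf.comp hd.differentiableOn fun c hc => hc).analyticOnNhd hopen).mono fun c hc =>
        heisenbergTranslate_smul_mem hw (by simpa using hc)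
    have h := ofReal_norm_rpow_le_lintegral_circle han hp
    rw [zero_smul, heisenbergTranslate_zero] at h
    refine h.trans_eq (lintegral_congr fun θ => ?_)
    rw [hF, Set.indicator_of_mem (heisenbergTranslate_smul_mem hw (by simp))]
  have hswap : ∫⁻ w, ∫⁻ θ in Set.Ioc 0 (2 * Real.pi),
        F (heisenbergTranslate z (circleMap 0 1 θ • w)) =
      ENNReal.ofReal (2 * Real.pi) * ∫⁻ w, F w := by
    rw [lintegral_lintegral_swap]
    · have (θ : ℝ) : ∫⁻ w, F (heisenbergTranslate z (circleMap 0 1 θ • w)) = ∫⁻ w, F w := by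
        have hR := measurePreserving_smul_of_norm_eq_one m (c := circleMap 0 1 θ) (by simp)
        exact (hT.comp hR).lintegral_comp hFm
      simp_rw [this]
      rw [setLIntegral_const, Real.volume_Ioc, sub_zero, mul_comm]
    · refine (hFm.comp (hT.measurable.comp ?_)).aemeasurable
      exact ((continuous_circleMap 0 1).measurable.comp measurable_snd).smul measurable_fst
  rw [← lintegral_indicator hU]
  refine (ENNReal.mul_le_mul_iff_right (a := ENNReal.ofReal (2 * Real.pi))
    (by simp [Real.pi_pos]) ENNReal.ofReal_ne_top).1 ?_
  rw [← hswap, ← mul_assoc, ← setLIntegral_const]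
  exact (setLIntegral_mono' (measurableSet_ballProdDisc m _) hslice).trans
    (setLIntegral_le_lintegral _ _)

/-- The growth estimate on `ℂ ^ m × ℂ`. -/
theorem norm_le_of_integrableOn_siegel {m : ℕ} {p : ℝ} (hp : 0 < p) {f : SPoint m → ℂ}
    (hd : DifferentiableOn ℂ f (Siegel m))
    (hi : IntegrableOn (fun w => ‖f w‖ ^ p) (Siegel m) volume) {z : SPoint m}
    (hz : z ∈ Siegel m) :
    ‖f z‖ ≤
      (4 ^ (m + 1) * ((m + 1).factorial : ℝ) / Real.pi ^ (m + 1)) ^ (1 / p) *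
        (∫ w in Siegel m, ‖f w‖ ^ p) ^ (1 / p) / srho z ^ ((((m + 1 : ℕ) : ℝ) + 1) / p) := by
  have hρ : 0 < srho z := mem_siegel_iff.1 hz
  set ρ := srho z
  set J := ∫ w in Siegel m, ‖f w‖ ^ p
  have hJ0 : 0 ≤ J := integral_nonneg fun _ => by positivity
  have key := norm_rpow_mul_volume_le hp hd z
  rw [volume_ballProdDisc m (half_pos hρ), ← ENNReal.ofReal_mul (by positivity),
    ← ofReal_integral_eq_lintegral_ofReal hi (Eventually.of_forall fun _ => by positivity),
    ENNReal.ofReal_le_ofReal_iff hJ0] at key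
  have hvol : Real.pi ^ (m + 1) * ρ ^ (m + 2) / (4 ^ (m + 1) * ((m + 1).factorial : ℝ)) ≤
      (Real.pi * (ρ / 2)) ^ m / m.factorial * (Real.pi * (ρ / 2) ^ 2) := by
    have h1 : (Real.pi * (ρ / 2)) ^ m / m.factorial * (Real.pi * (ρ / 2) ^ 2) =
        Real.pi ^ (m + 1) * ρ ^ (m + 2) / (2 ^ (m + 2) * m.factorial) := by
      rw [mul_pow, div_pow, div_pow]
      field_simp
      ring
    rw [h1]
    have h4 : (2 : ℝ) ^ (m + 2) ≤ 4 ^ (m + 1) := by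
      rw [show (4 : ℝ) = 2 ^ 2 by norm_num, ← pow_mul]
      exact pow_le_pow_right₀ one_le_two (by omega)
    have h5 : (m.factorial : ℝ) ≤ (m + 1).factorial := by
      exact_mod_cast Nat.factorial_le (Nat.le_succ m)
    gcongr
  have hbound : ‖f z‖ ^ p ≤
      4 ^ (m + 1) * ((m + 1).factorial : ℝ) / Real.pi ^ (m + 1) * J / ρ ^ (m + 2) := by
    have h := (mul_le_mul_of_nonneg_left hvol (Real.rpow_nonneg (norm_nonneg (f z)) p)).trans key
    rw [le_div_iff₀ (by positivity), div_mul_eq_mul_div, le_div_iff₀ (by positivity)]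
    rw [mul_div_assoc', div_le_iff₀ (by positivity)] at h
    linarith
  have hroot := Real.rpow_le_rpow (by positivity) hbound (one_div_pos.2 hp).le
  rw [← Real.rpow_mul (norm_nonneg _), mul_one_div_cancel hp.ne', Real.rpow_one,
    Real.div_rpow (by positivity) (by positivity), Real.mul_rpow (by positivity) hJ0,
    ← Real.rpow_natCast ρ, ← Real.rpow_mul hρ.le, mul_one_div] at hroot
  have hexp : ((m + 1 : ℕ) : ℝ) + 1 = ((m + 2 : ℕ) : ℝ) := by push_cast; ring
  rw [hexp]
  exact hroot

/-- growth estimate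
`|f(z)| ≤ (4ⁿ n!/πⁿ)^{1/p} ‖f‖ₚ / ρ(z)^{(n+1)/p}` for `f ∈ Aᵖ(𝒰)`. -/
theorem growth_estimate (n : ℕ) (hn : 1 ≤ n) (p : ℝ) (hp : 0 < p)
    (f : SPoint (n - 1) → ℂ) (hf : MemAp n p f) (z : SPoint (n - 1))
    (hz : z ∈ Siegel (n - 1)) :
    ‖f z‖ ≤
      (4 ^ n * (n.factorial : ℝ) / Real.pi ^ n) ^ (1 / p) *
        bNorm n p f / srho z ^ (((n : ℝ) + 1) / p) := by
  obtain ⟨m, rfl⟩ : ∃ m, n = m + 1 := ⟨n - 1, by omega⟩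
  exact norm_le_of_integrableOn_siegel hp hf.1 hf.2 hz
end

section
/- Let 1 < p < ∞ and p′ = p/(p−1). For every compact set E ⊆ 𝒰, the quantity ρ(z)^{(n+1)/p′} · sup_{w ∈ E} |K(w,z)| tends to 0 along the cocompact filter of 𝒰, i.e. for every ε > 0 there is a compact set F ⊆ 𝒰 such that ρ(z)^{(n+1)/p′} · sup_{w ∈ E} |K(w,z)| ≤ ε for all z ∈ 𝒰 ∖ F. (Equivalently, the normalized kernels K_z/‖K_z‖ₚ converge to 0 weakly in Aᵖ(𝒰) as z → ∂𝒰̂.) -/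
open MeasureTheory Filter

open Topology

/-- `2 Re ρ(w,z) = ρ(w) + ρ(z) + |w′ − z′|²`. -/
theorem two_mul_re_srho2 {m : ℕ} (w z : SPoint m) :
    2 * (srho2 w z).re = srho w + srho z + ∑ j, ‖w.1 j - z.1 j‖ ^ 2 := by
  have h : ∑ j, ‖w.1 j - z.1 j‖ ^ 2 = ∑ j, ‖w.1 j‖ ^ 2 + ∑ j, ‖z.1 j‖ ^ 2
      - 2 * ∑ j, (w.1 j * (starRingEnd ℂ) (z.1 j)).re := by
    rw [Finset.mul_sum, ← Finset.sum_add_distrib, ← Finset.sum_sub_distrib]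
    refine Finset.sum_congr rfl fun j _ => ?_
    simp only [Complex.sq_norm, Complex.normSq_sub]
  have h' : (srho2 w z).re = (w.2.im + z.2.im) / 2
      - ∑ j, (w.1 j * (starRingEnd ℂ) (z.1 j)).re := by
    rw [srho2, Complex.sub_re, Complex.re_sum]
    congr 1
    simp [Complex.mul_re]
    ring
  rw [h, h', srho, srho]
  ring

theorem srho_add_srho_add_sum_le {m : ℕ} (w z : SPoint m) :
    srho w + srho z + ∑ j, ‖w.1 j - z.1 j‖ ^ 2 ≤ 2 * ‖srho2 w z‖ := by
  rw [← two_mul_re_srho2]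
  linarith [Complex.re_le_norm (srho2 w z)]

theorem continuous_srho {m : ℕ} : Continuous (srho : SPoint m → ℝ) := by
  unfold srho
  fun_prop

/-- If `w` is bounded and `ρ(w,z)` is bounded, then `z` is bounded. -/
theorem norm_le_of_norm_srho2_le {m : ℕ} {w z : SPoint m} {M R : ℝ}
    (hw : w ∈ Siegel m) (hz : z ∈ Siegel m) (hM : ‖w‖ ≤ M) (hR : ‖srho2 w z‖ ≤ R) :
    ‖z‖ ≤ (M + (2 * R + 1)) + (M + 2 * (R + m * (M * (M + (2 * R + 1))))) := by
  have hM0 : 0 ≤ M := (norm_nonneg w).trans hM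
  have hR0 : 0 ≤ R := (norm_nonneg _).trans hR
  have hw0 : 0 < srho w := hw
  have hz0 : 0 < srho z := hz
  have hwj (j : Fin m) : ‖w.1 j‖ ≤ M := ((norm_le_pi_norm w.1 j).trans (norm_fst_le w)).trans hM
  have hzj (j : Fin m) : ‖z.1 j‖ ≤ M + (2 * R + 1) := by
    have h1 : ‖w.1 j - z.1 j‖ ^ 2 ≤ ∑ j, ‖w.1 j - z.1 j‖ ^ 2 :=
      Finset.single_le_sum (f := fun j => ‖w.1 j - z.1 j‖ ^ 2)
        (fun _ _ => by positivity) (Finset.mem_univ j)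
    have h2 := srho_add_srho_add_sum_le w z
    have h3 : ‖w.1 j - z.1 j‖ ≤ 2 * R + 1 := by nlinarith [norm_nonneg (w.1 j - z.1 j)]
    have h4 := norm_sub_norm_le (z.1 j) (w.1 j)
    rw [norm_sub_rev] at h4
    linarith [hwj j]
  have hsum : ‖∑ j, w.1 j * (starRingEnd ℂ) (z.1 j)‖ ≤ m * (M * (M + (2 * R + 1))) := by
    refine (norm_sum_le_of_le Finset.univ (f := fun j => w.1 j * (starRingEnd ℂ) (z.1 j))
      (n := fun _ => M * (M + (2 * R + 1))) fun j _ => ?_).trans (by simp)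
    rw [norm_mul, RCLike.norm_conj]
    exact mul_le_mul (hwj j) (hzj j) (norm_nonneg _) hM0
  have hz2 : ‖z.2‖ ≤ M + 2 * (R + m * (M * (M + (2 * R + 1)))) := by
    have h1 : Complex.I / 2 * ((starRingEnd ℂ) z.2 - w.2)
        = srho2 w z + ∑ j, w.1 j * (starRingEnd ℂ) (z.1 j) := by
      rw [srho2]
      ring
    have h2 : ‖(starRingEnd ℂ) z.2 - w.2‖ / 2
        = ‖srho2 w z + ∑ j, w.1 j * (starRingEnd ℂ) (z.1 j)‖ := by
      rw [← h1, norm_mul, norm_div, Complex.norm_I, Complex.norm_ofNat]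
      ring
    have h3 := norm_add_le (srho2 w z) (∑ j, w.1 j * (starRingEnd ℂ) (z.1 j))
    have h4 := norm_sub_norm_le ((starRingEnd ℂ) z.2) w.2
    rw [RCLike.norm_conj] at h4
    linarith [(norm_snd_le w).trans hM]
  have hz1 : ‖z.1‖ ≤ M + (2 * R + 1) := (pi_norm_le_iff_of_nonneg (by positivity)).2 hzj
  rw [Prod.norm_def]
  exact max_le (hz1.trans (le_add_of_nonneg_right (by positivity)))
    (hz2.trans (le_add_of_nonneg_left (by positivity)))

/-- for every compact `E ⊆ 𝒰`, `ρ(z)^{(n+1)/p′} sup_{w∈E} |K(w,z)| → 0`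
along the cocompact filter of `𝒰` (normalized kernels tend to 0 weakly). -/
theorem normalized_kernel_weak_null (n : ℕ) (hn : 1 ≤ n) (p : ℝ) (hp : 1 < p)
    (E : Set (SPoint (n - 1))) (hE : E ⊆ Siegel (n - 1)) (hEc : IsCompact E) :
    ∀ ε > (0 : ℝ), ∃ F : Set (SPoint (n - 1)), F ⊆ Siegel (n - 1) ∧ IsCompact F ∧
      ∀ z ∈ Siegel (n - 1) \ F, ∀ w ∈ E,
        srho z ^ (((n : ℝ) + 1) / (p / (p - 1))) * ‖sK n w z‖ ≤ ε := by
  intro ε hε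
  set a : ℝ := ((n : ℝ) + 1) / (p / (p - 1)) with ha
  set C : ℝ := ‖(n.factorial : ℂ) / (4 * (Real.pi : ℂ) ^ n)‖
  have hC0 : 0 ≤ C := norm_nonneg _
  have hp1 : 0 < p - 1 := by linarith
  have hp0 : 0 < p := by linarith
  have ha0 : 0 < a := by positivity
  have haN : 0 < (n + 1 : ℝ) - a := by
    have : (n + 1 : ℝ) - a = (n + 1) / p := by
      rw [ha]
      field_simp
      ring
    rw [this]
    positivity
  have hK (w z : SPoint (n - 1)) : ‖sK n w z‖ = C * (‖srho2 w z‖ ^ (n + 1))⁻¹ := by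
    rw [sK, norm_mul, norm_zpow, zpow_neg, ← Nat.cast_add_one, zpow_natCast]
  rcases E.eq_empty_or_nonempty with rfl | hne
  · exact ⟨∅, Set.empty_subset _, isCompact_empty, by simp⟩
  obtain ⟨w₀, hw₀, hmin⟩ := hEc.exists_isMinOn hne continuous_srho.continuousOn
  obtain ⟨δ, hδ, hδE⟩ : ∃ δ > 0, ∀ w ∈ E, δ ≤ srho w := ⟨srho w₀, hE hw₀, hmin⟩
  obtain ⟨M, hM⟩ := hEc.isBounded.exists_norm_le
  -- Far away: `|ρ(w,z)| ≥ R`.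
  obtain ⟨R, hR0, hR⟩ : ∃ R > 0, ∀ t ≥ R, C * (2 ^ a * t ^ (-((n + 1 : ℝ) - a))) ≤ ε := by
    have h : Tendsto (fun t : ℝ => C * (2 ^ a * t ^ (-((n + 1 : ℝ) - a)))) atTop (𝓝 0) := by
      simpa using ((tendsto_rpow_neg_atTop haN).const_mul (2 ^ a)).const_mul C
    obtain ⟨R, hR⟩ := eventually_atTop.1
      ((h.eventually_le_const hε).and (eventually_gt_atTop 0))
    exact ⟨R, (hR R le_rfl).2, fun t ht => (hR t ht).1⟩
  -- Near the finite boundary: `ρ(z) < η`.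
  obtain ⟨η, hη0, hη⟩ : ∃ η > 0, η ^ a * (C * ((δ / 2) ^ (n + 1))⁻¹) ≤ ε := by
    have h : Tendsto (fun t : ℝ => t ^ a * (C * ((δ / 2) ^ (n + 1))⁻¹)) (𝓝[>] 0) (𝓝 0) := by
      have h' := ((Real.continuous_rpow_const ha0.le).tendsto 0).mul_const
        (C * ((δ / 2) ^ (n + 1))⁻¹)
      rw [Real.zero_rpow ha0.ne', zero_mul] at h'
      exact h'.mono_left nhdsWithin_le_nhds
    obtain ⟨η, hη, hη0⟩ := ((h.eventually_le_const hε).and self_mem_nhdsWithin).exists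
    exact ⟨η, hη0, hη⟩
  set B : ℝ := (M + (2 * R + 1)) + (M + 2 * (R + (n - 1 : ℕ) * (M * (M + (2 * R + 1)))))
  refine ⟨Metric.closedBall 0 B ∩ {z | η ≤ srho z}, fun z hz => hη0.trans_le hz.2,
    (isCompact_closedBall _ _).inter_right (isClosed_le continuous_const continuous_srho), ?_⟩
  rintro z ⟨hz, hzF⟩ w hw
  have hz0 : 0 < srho z := hz
  have hle := srho_add_srho_add_sum_le w z
  have hsum : 0 ≤ ∑ j, ‖w.1 j - z.1 j‖ ^ 2 := Finset.sum_nonneg fun _ _ => by positivity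
  have hδw := hδE w hw
  have hpos : 0 < ‖srho2 w z‖ := by linarith
  rw [hK]
  rcases le_total R ‖srho2 w z‖ with hfar | hnear
  · have h1 : srho z ^ a ≤ 2 ^ a * ‖srho2 w z‖ ^ a := by
      rw [← Real.mul_rpow zero_le_two hpos.le]
      exact Real.rpow_le_rpow hz0.le (by linarith) ha0.le
    calc srho z ^ a * (C * (‖srho2 w z‖ ^ (n + 1))⁻¹)
        ≤ (2 ^ a * ‖srho2 w z‖ ^ a) * (C * (‖srho2 w z‖ ^ (n + 1))⁻¹) := by gcongr
      _ = C * (2 ^ a * ‖srho2 w z‖ ^ (-((n + 1 : ℝ) - a))) := by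
        rw [neg_sub, Real.rpow_sub hpos, ← Nat.cast_add_one, Real.rpow_natCast]
        ring
      _ ≤ ε := hR _ hfar
  · have hzη : srho z ≤ η := by
      by_contra! h
      exact hzF ⟨mem_closedBall_zero_iff.2
        (norm_le_of_norm_srho2_le (hE hw) hz (hM w hw) hnear), h.le⟩
    refine le_trans ?_ hη
    gcongr
    linarith
end
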